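/- arXiv:1801.03574 — 3 statements merged into one kernel-verified Lean document; each statement's English description precedes it below -/
import Mathlib

section
/- Let (V,C) be a martingale selection problem, let t ∈ I ∖ {T}, and assume W_{t+1}(ω) ≠ ∅ for every ω ∈ Ω. Then for every ω ∈ Ω: W_{t+1}^♭(ω) − C_t(ω) = {y ∈ ℝ^d : for every ω̄ ∈ Σ_t^ω there exist ξ ∈ L(F_{t+1};W_{t+1}) and Q ∈ 𝒫(ω̄) such that E_Q[ξ|F_t](ω) − y ∈ C_t(ω)}. -/
open Set MeasureTheory Pointwise

namespace MSPPaper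

section Defs

variable {Ω E : Type*}

/-- A finitely supported probability measure on `Ω`: finite support, strictly
positive weights on the support, total mass one. -/
structure FinProb (Ω : Type*) where
  supp : Finset Ω
  w : Ω → ℝ
  pos : ∀ ω ∈ supp, 0 < w ω
  zero : ∀ ω ∉ supp, w ω = 0
  sum_one : ∑ ω ∈ supp, w ω = 1

/-- The measure of a set under a finitely supported probability. -/
noncomputable def FinProb.meas (Q : FinProb Ω) (A : Set Ω) : ℝ :=
  letI := Classical.decPred fun ω => ω ∈ A
  ∑ ω ∈ Q.supp.filter (fun ω => ω ∈ A), Q.w ω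

/-- The level set `Σ_t^ω` of the process `ψ`. -/
def level (ψ : ℕ → Ω → E) (t : ℕ) (ω : Ω) : Set Ω :=
  {ω' | ∀ s ≤ t, ψ s ω' = ψ s ω}

/-- The conditional expectation `E_Q[ξ | F_t](ω)`. -/
noncomputable def condExp {F : Type*} [AddCommMonoid F] [Module ℝ F]
    (ψ : ℕ → Ω → E) (t : ℕ) (Q : FinProb Ω) (ξ : Ω → F) (ω : Ω) : F :=
  letI := Classical.decPred fun ω' => ω' ∈ level ψ t ω
  (Q.meas (level ψ t ω))⁻¹ •
    ∑ ω' ∈ Q.supp.filter (fun ω' => ω' ∈ level ψ t ω), Q.w ω' • ξ ω'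

variable [MeasurableSpace E]

/-- The natural filtration `F̂_t` generated by `ψ_0, …, ψ_t`. -/
def natFilt (ψ : ℕ → Ω → E) (t : ℕ) : MeasurableSpace Ω :=
  ⨆ s ∈ Finset.range (t + 1), MeasurableSpace.comap (ψ s) inferInstance

/-- The `P`-null sets relative to `F̂_t`. -/
def nullSets (ψ : ℕ → Ω → E) (P : FinProb Ω) (t : ℕ) : Set (Set Ω) :=
  {A | ∃ A', A ⊆ A' ∧ MeasurableSet[natFilt ψ t] A' ∧ P.meas A' = 0}

/-- The completed filtration `F_t`. -/
def filt (ψ : ℕ → Ω → E) (t : ℕ) : MeasurableSpace Ω :=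
  ⨅ P : FinProb Ω,
    MeasurableSpace.generateFrom ({A | MeasurableSet[natFilt ψ t] A} ∪ nullSets ψ P t)

/-- `G`-measurability of a correspondence. -/
def CorrMeasurable {F : Type*} [TopologicalSpace F]
    (G : MeasurableSpace Ω) (U : Ω → Set F) : Prop :=
  ∀ O : Set F, IsOpen O → MeasurableSet[G] {ω | (U ω ∩ O).Nonempty}

/-- The set `L(G; U)` of `G`-measurable selections of `U`. -/
def Selections {F : Type*} [MeasurableSpace F]
    (G : MeasurableSpace Ω) (U : Ω → Set F) : Set (Ω → F) :=
  {ξ | Measurable[G] ξ ∧ ∀ ω, ξ ω ∈ U ω}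

/-- The correspondence `U^♯` (taken at stage `t`). -/
def sharp {d : ℕ} (ψ : ℕ → Ω → E) (t : ℕ) (U : Ω → Set (Fin d → ℝ)) (ω : Ω) :
    Set (Fin d → ℝ) :=
  convexHull ℝ (⋃ ω' ∈ level ψ t ω, U ω')

/-- The correspondence `U^♭` (taken at stage `t`). -/
def flat {d : ℕ} (ψ : ℕ → Ω → E) (t : ℕ) (U : Ω → Set (Fin d → ℝ)) (ω : Ω) :
    Set (Fin d → ℝ) :=
  ⋂ ω' ∈ level ψ t ω, ⋃ l ∈ Ioo (0 : ℝ) 1, (l • U ω' + (1 - l) • sharp ψ t U ω)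

/-- The backward iteration defining `W`, indexed from the terminal date. -/
def Wrev {d : ℕ} (ψ : ℕ → Ω → E) (T : ℕ) (V C : ℕ → Ω → Set (Fin d → ℝ)) :
    ℕ → Ω → Set (Fin d → ℝ)
  | 0 => V T
  | (k + 1) => fun ω =>
      V (T - (k + 1)) ω ∩
        (flat ψ (T - (k + 1)) (Wrev ψ T V C k) ω - C (T - (k + 1)) ω)

/-- The sequence `W_t`: `W_T = V_T` and `W_t = V_t ∩ (W_{t+1}^♭ − C_t)` for `t < T`. -/
def W {d : ℕ} (ψ : ℕ → Ω → E) (T : ℕ) (V C : ℕ → Ω → Set (Fin d → ℝ)) (t : ℕ) :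
    Ω → Set (Fin d → ℝ) :=
  Wrev ψ T V C (T - t)

/-- The defining hypotheses of a martingale selection problem `(V, C)`:
adapted measurable correspondences, `V_t(ω)` convex and relatively open,
`C_t(ω)` closed and convex. -/
def IsMSP {d : ℕ} (ψ : ℕ → Ω → E) (T : ℕ) (V C : ℕ → Ω → Set (Fin d → ℝ)) : Prop :=
  ∀ t ≤ T,
    CorrMeasurable (filt ψ t) (V t) ∧ CorrMeasurable (filt ψ t) (C t) ∧
    ∀ ω : Ω, Convex ℝ (V t ω) ∧ V t ω = intrinsicInterior ℝ (V t ω) ∧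
      IsClosed (C t ω) ∧ Convex ℝ (C t ω)

/-- `(ξ, Q)` is a solution of the martingale selection problem `(V, C)`. -/
def IsSolution {d : ℕ} (ψ : ℕ → Ω → E) (T : ℕ) (V C : ℕ → Ω → Set (Fin d → ℝ))
    (ξ : ℕ → Ω → (Fin d → ℝ)) (Q : FinProb Ω) : Prop :=
  (∀ t ≤ T, ξ t ∈ Selections (filt ψ t) (V t)) ∧
  (∀ t, t + 1 ≤ T → ∀ ω ∈ Q.supp, condExp ψ t Q (ξ (t + 1)) ω - ξ t ω ∈ C t ω)

/-- Solvability of the martingale selection problem: a local solution exists at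
every point of `Ω`. -/
def Solvable {d : ℕ} (ψ : ℕ → Ω → E) (T : ℕ) (V C : ℕ → Ω → Set (Fin d → ℝ)) : Prop :=
  ∀ ωb : Ω, ∃ (ξ : ℕ → Ω → (Fin d → ℝ)) (Q : FinProb Ω),
    ωb ∈ Q.supp ∧ IsSolution ψ T V C ξ Q

/-- The positive polar cone of a subset of `ℝ^d`. -/
def polar {d : ℕ} (B : Set (Fin d → ℝ)) : Set (Fin d → ℝ) :=
  {y | ∀ x ∈ B, 0 ≤ ∑ i, y i * x i}

/-- A closed convex cone (containing the origin). -/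
def IsClosedConvexCone {F : Type*} [TopologicalSpace F] [AddCommMonoid F] [Module ℝ F]
    (A : Set F) : Prop :=
  IsClosed A ∧ Convex ℝ A ∧ (0 : F) ∈ A ∧ ∀ c : ℝ, 0 < c → ∀ x ∈ A, c • x ∈ A

end Defs

section RelativeInterior

variable {F : Type*} [NormedAddCommGroup F] [NormedSpace ℝ F]

theorem exists_ball_of_mem_intrinsicInterior {A : Set F} {a : F}
    (ha : a ∈ intrinsicInterior ℝ A) :
    ∃ δ > 0, ∀ z ∈ affineSpan ℝ A, dist z a < δ → z ∈ A := by
  obtain ⟨a', ha', rfl⟩ := mem_intrinsicInterior.1 ha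
  obtain ⟨δ, hδ, hball⟩ := Metric.mem_nhds_iff.1 (mem_interior_iff_mem_nhds.1 ha')
  exact ⟨δ, hδ, fun z hz hza => hball (a := ⟨z, hz⟩) hza⟩

theorem exists_extension_of_mem_intrinsicInterior {A : Set F} {a b : F}
    (ha : a ∈ intrinsicInterior ℝ A) (hb : b ∈ affineSpan ℝ A) :
    ∃ μ ∈ Ioo (0 : ℝ) 1, ∃ c ∈ A, a = μ • b + (1 - μ) • c := by
  obtain ⟨δ, hδ, hA⟩ := exists_ball_of_mem_intrinsicInterior ha
  have hcont : Continuous fun ε : ℝ => AffineMap.lineMap a b (-ε) :=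
    (AffineMap.lineMap_continuous (p := a) (q := b)).comp continuous_neg
  obtain ⟨η, hη, hηδ⟩ := Metric.continuous_iff.1 hcont 0 δ hδ
  have hε : (0 : ℝ) < η / 2 := by positivity
  have hc : AffineMap.lineMap a b (-(η / 2)) ∈ A := by
    refine hA _ (AffineMap.lineMap_mem _
      (subset_affineSpan ℝ A (intrinsicInterior_subset ha)) hb) ?_
    have := hηδ (η / 2) (by simp [abs_of_pos hη, hη])
    simpa using this
  refine ⟨(η / 2) / (1 + η / 2), ⟨by positivity, by rw [div_lt_one] <;> linarith⟩, _, hc, ?_⟩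
  have hne : 1 + η / 2 ≠ 0 := by positivity
  rw [AffineMap.lineMap_apply_module]
  match_scalars <;> field_simp <;> ring

theorem subset_of_closure_eq_of_relatively_open [FiniteDimensional ℝ F] {A B : Set F}
    (hB : Convex ℝ B) (hAo : A = intrinsicInterior ℝ A) (hBo : B = intrinsicInterior ℝ B)
    (h : closure A = closure B) : A ⊆ B := by
  intro x hx
  have hspan : affineSpan ℝ A = affineSpan ℝ B := by
    rw [← affineSpan_intrinsicClosure A, ← affineSpan_intrinsicClosure B,
      intrinsicClosure_eq_closure, intrinsicClosure_eq_closure, h]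
  obtain ⟨y, hy⟩ : B.Nonempty := closure_nonempty_iff.1 (h ▸ ⟨x, subset_closure hx⟩)
  have hyA : y ∈ affineSpan ℝ A := hspan ▸ subset_affineSpan ℝ B hy
  have hxB : x ∈ affineSpan ℝ B := hspan ▸ subset_affineSpan ℝ A hx
  obtain ⟨μ, ⟨hμ0, hμ1⟩, x', hx', hxx'⟩ :=
    exists_extension_of_mem_intrinsicInterior (hAo ▸ hx) hyA
  obtain ⟨δ, hδ, hball⟩ := exists_ball_of_mem_intrinsicInterior (hBo ▸ hy)
  have hx'B : x' ∈ closure B := h ▸ subset_closure hx'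
  have hcont : Continuous fun z : F => AffineMap.lineMap z x μ⁻¹ := by
    simp only [AffineMap.lineMap_apply_module]
    fun_prop
  have hval : AffineMap.lineMap x' x μ⁻¹ = y := by
    rw [AffineMap.lineMap_apply_module, hxx']
    match_scalars <;> field_simp
    ring
  obtain ⟨η, hη, hηδ⟩ := Metric.continuous_iff.1 hcont x' δ hδ
  obtain ⟨z, hz, hzx'⟩ := Metric.mem_closure_iff.1 hx'B η hη
  have hy' : AffineMap.lineMap z x μ⁻¹ ∈ B :=
    hball _ (AffineMap.lineMap_mem _ (subset_affineSpan ℝ B hz) hxB)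
      (hval ▸ hηδ z (by rwa [dist_comm]))
  have hcombo := hB hy' hz hμ0.le (sub_nonneg.2 hμ1.le) (by ring)
  convert hcombo using 1
  rw [AffineMap.lineMap_apply_module]
  match_scalars <;> field_simp
  ring

end RelativeInterior

section Filtration

variable {Ω E : Type*}

theorem mem_level_comm {ψ : ℕ → Ω → E} {t : ℕ} {ω ω' : Ω} :
    ω' ∈ level ψ t ω ↔ ω ∈ level ψ t ω' :=
  ⟨fun h s hs => (h s hs).symm, fun h s hs => (h s hs).symm⟩

theorem mem_level_self (ψ : ℕ → Ω → E) (t : ℕ) (ω : Ω) : ω ∈ level ψ t ω :=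
  fun _ _ => rfl

theorem level_eq_of_mem {ψ : ℕ → Ω → E} {t : ℕ} {ω ω' : Ω} (h : ω' ∈ level ψ t ω) :
    level ψ t ω' = level ψ t ω := by
  ext q
  exact ⟨fun hq s hs => (hq s hs).trans (h s hs), fun hq s hs => (hq s hs).trans (h s hs).symm⟩

theorem level_succ_subset (ψ : ℕ → Ω → E) (t : ℕ) (ω : Ω) :
    level ψ (t + 1) ω ⊆ level ψ t ω :=
  fun _ h s hs => h s (hs.trans t.le_succ)

/-- The Dirac measure as a finitely supported probability. -/
noncomputable def FinProb.dirac (ω : Ω) : FinProb Ω where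
  supp := {ω}
  w := by classical exact Pi.single ω 1
  pos := by simp
  zero := by
    intro ω' h
    simp only [Finset.mem_singleton] at h
    simp [h]
  sum_one := by simp

@[simp]
theorem FinProb.dirac_supp (ω : Ω) : (FinProb.dirac ω).supp = {ω} := rfl

@[simp]
theorem FinProb.dirac_w_self (ω : Ω) : (FinProb.dirac ω).w ω = 1 := by
  simp [FinProb.dirac]

theorem FinProb.notMem_of_meas_eq_zero {Q : FinProb Ω} {A : Set Ω} (h : Q.meas A = 0)
    {ω : Ω} (hω : ω ∈ Q.supp) : ω ∉ A := by
  intro hA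
  classical
  rw [FinProb.meas, Finset.sum_eq_zero_iff_of_nonneg] at h
  · exact (Q.pos ω hω).ne' (h ω (by simp [hω, hA]))
  · intro q hq
    exact (Q.pos q (Finset.mem_filter.1 hq).1).le

theorem FinProb.meas_eq_zero {Q : FinProb Ω} {A : Set Ω} (h : ∀ ω ∈ Q.supp, ω ∉ A) :
    Q.meas A = 0 := by
  classical
  refine Finset.sum_eq_zero fun q hq => ?_
  rw [Finset.mem_filter] at hq
  exact absurd hq.2 (h q hq.1)

variable [MeasurableSpace E]

theorem measurableSet_natFilt_level [MeasurableSingletonClass E] (ψ : ℕ → Ω → E) (t : ℕ)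
    (ω : Ω) : MeasurableSet[natFilt ψ t] (level ψ t ω) := by
  have h : level ψ t ω = ⋂ s ∈ Finset.range (t + 1), ψ s ⁻¹' {ψ s ω} := by
    ext q
    simp [level]
  rw [h]
  refine @Finset.measurableSet_biInter _ _ (natFilt ψ t) _ _ fun s hs => ?_
  have hle : MeasurableSpace.comap (ψ s) inferInstance ≤ natFilt ψ t :=
    le_iSup₂_of_le (f := fun s (_ : s ∈ Finset.range (t + 1)) =>
      MeasurableSpace.comap (ψ s) inferInstance) s hs le_rfl
  exact hle _ ⟨_, measurableSet_singleton _, rfl⟩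

theorem mem_iff_of_measurableSet_natFilt {ψ : ℕ → Ω → E} {t : ℕ} {A : Set Ω}
    (hA : MeasurableSet[natFilt ψ t] A) {ω ω' : Ω} (h : ω' ∈ level ψ t ω) :
    ω' ∈ A ↔ ω ∈ A := by
  let m : MeasurableSpace Ω :=
    { MeasurableSet' := fun A => ω' ∈ A ↔ ω ∈ A
      measurableSet_empty := by simp
      measurableSet_compl := fun A hA => not_congr hA
      measurableSet_iUnion := fun f hf => by simp only [mem_iUnion, hf] }
  have hle : natFilt ψ t ≤ m := by
    refine iSup₂_le fun s hs => ?_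
    rintro _ ⟨B, -, rfl⟩
    change ψ s ω' ∈ B ↔ ψ s ω ∈ B
    rw [h s (Nat.lt_succ_iff.1 (Finset.mem_range.1 hs))]
  exact hle _ hA

theorem mem_iff_of_measurableSet_filt {ψ : ℕ → Ω → E} {t : ℕ} {A : Set Ω}
    (hA : MeasurableSet[filt ψ t] A) {ω ω' : Ω} (h : ω' ∈ level ψ t ω) :
    ω' ∈ A ↔ ω ∈ A := by
  let m : MeasurableSpace Ω :=
    { MeasurableSet' := fun A => ω' ∈ A ↔ ω ∈ A
      measurableSet_empty := by simp
      measurableSet_compl := fun A hA => not_congr hA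
      measurableSet_iUnion := fun f hf => by simp only [mem_iUnion, hf] }
  have hle : filt ψ t ≤ m := by
    refine (iInf_le _ (FinProb.dirac ω)).trans (MeasurableSpace.generateFrom_le ?_)
    rintro B (hB | ⟨B', hBB', hB', hnull⟩)
    · exact mem_iff_of_measurableSet_natFilt hB h
    · have hω : ω ∉ B' := FinProb.notMem_of_meas_eq_zero hnull (by simp)
      have hω' : ω' ∉ B' := fun h' => hω ((mem_iff_of_measurableSet_natFilt hB' h).1 h')
      exact iff_of_false (fun h' => hω' (hBB' h')) fun h' => hω (hBB' h')
  exact hle _ hA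

theorem measurableSet_filt_of_forall_level [MeasurableSingletonClass E] {ψ : ℕ → Ω → E} {t : ℕ}
    {A : Set Ω} (hA : ∀ ω, ∀ ω' ∈ level ψ t ω, ω ∈ A → ω' ∈ A) :
    MeasurableSet[filt ψ t] A := by
  classical
  rw [filt, MeasurableSpace.measurableSet_iInf]
  intro P
  set G := {A | MeasurableSet[natFilt ψ t] A} ∪ nullSets ψ P t
  have hlevels : ∀ S : Finset Ω, MeasurableSet[natFilt ψ t] (⋃ q ∈ S, level ψ t q) := fun S =>
    @Finset.measurableSet_biUnion _ _ (natFilt ψ t) _ S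
      fun q _ => measurableSet_natFilt_level ψ t q
  have hsplit : A = (⋃ q ∈ P.supp.filter (· ∈ A), level ψ t q) ∪
      A \ ⋃ q ∈ P.supp, level ψ t q := by
    ext a
    simp only [mem_union, mem_iUnion, mem_sdiff, Finset.mem_filter, exists_prop, not_exists,
      not_and]
    constructor
    · intro ha
      by_cases hq : ∃ q ∈ P.supp, a ∈ level ψ t q
      · obtain ⟨q, hq, haq⟩ := hq
        exact Or.inl ⟨q, ⟨hq, hA a q (mem_level_comm.1 haq) ha⟩, haq⟩
      · push Not at hq
        exact Or.inr ⟨ha, hq⟩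
    · rintro (⟨q, ⟨-, hqA⟩, haq⟩ | h)
      · exact hA q a haq hqA
      · exact h.1
  rw [hsplit]
  refine @MeasurableSet.union _ (MeasurableSpace.generateFrom G) _ _
    (MeasurableSpace.measurableSet_generateFrom (Or.inl (hlevels _)))
    (MeasurableSpace.measurableSet_generateFrom (Or.inr
      ⟨(⋃ q ∈ P.supp, level ψ t q)ᶜ, fun _ h => h.2,
        @MeasurableSet.compl _ _ (natFilt ψ t) (hlevels _), FinProb.meas_eq_zero ?_⟩))
  intro q hq hq'
  exact hq' (mem_biUnion hq (mem_level_self ψ t q))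

theorem measurable_filt_of_forall_level [MeasurableSingletonClass E] {F : Type*}
    [MeasurableSpace F] {ψ : ℕ → Ω → E} {t : ℕ} {ξ : Ω → F}
    (hξ : ∀ ω, ∀ ω' ∈ level ψ t ω, ξ ω' = ξ ω) : Measurable[filt ψ t] ξ := by
  intro B _
  refine measurableSet_filt_of_forall_level fun ω ω' h hω => ?_
  rw [mem_preimage, hξ ω ω' h]
  exact hω

theorem CorrMeasurable.closure_subset {F : Type*} [TopologicalSpace F] {ψ : ℕ → Ω → E} {t : ℕ}
    {U : Ω → Set F} (hU : CorrMeasurable (filt ψ t) U) {ω ω' : Ω} (h : ω' ∈ level ψ t ω) :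
    closure (U ω') ⊆ closure (U ω) := by
  intro x hx
  rw [mem_closure_iff] at hx ⊢
  intro O hO hxO
  have hω' : (U ω' ∩ O).Nonempty := inter_comm O _ ▸ hx O hO hxO
  rw [inter_comm]
  exact (mem_iff_of_measurableSet_filt (hU O hO) h).1 hω'

theorem CorrMeasurable.closure_eq {F : Type*} [TopologicalSpace F] {ψ : ℕ → Ω → E} {t : ℕ}
    {U : Ω → Set F} (hU : CorrMeasurable (filt ψ t) U) {ω ω' : Ω} (h : ω' ∈ level ψ t ω) :
    closure (U ω') = closure (U ω) :=
  (hU.closure_subset h).antisymm (hU.closure_subset (mem_level_comm.1 h))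

end Filtration

section Flat

variable {Ω E : Type*} {d : ℕ} {ψ : ℕ → Ω → E} {t : ℕ}

theorem convex_iUnion_combo {F : Type*} [AddCommGroup F] [Module ℝ F] {A S : Set F}
    (hA : Convex ℝ A) (hS : Convex ℝ S) :
    Convex ℝ (⋃ l ∈ Ioo (0 : ℝ) 1, (l • A + (1 - l) • S)) := by
  intro x hx y hy p r hp hr hpr
  simp only [mem_iUnion, exists_prop, mem_add, mem_smul_set] at hx hy ⊢
  obtain ⟨l, ⟨hl0, hl1⟩, _, ⟨a, ha, rfl⟩, _, ⟨s, hs, rfl⟩, rfl⟩ := hx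
  obtain ⟨k, ⟨hk0, hk1⟩, _, ⟨b, hb, rfl⟩, _, ⟨u, hu, rfl⟩, rfl⟩ := hy
  have hr' : r = 1 - p := by linarith
  have hm0 : 0 < p * l + r * k := by
    rcases hp.eq_or_lt with rfl | hp'
    · simp_all
    · have := mul_pos hp' hl0
      have := mul_nonneg hr hk0.le
      linarith
  have hn0 : 0 < p * (1 - l) + r * (1 - k) := by
    rcases hp.eq_or_lt with rfl | hp'
    · simp_all
    · have := mul_pos hp' (sub_pos.2 hl1)
      have := mul_nonneg hr (sub_pos.2 hk1).le
      linarith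
  have hmn : 1 - (p * l + r * k) = p * (1 - l) + r * (1 - k) := by
    rw [hr']; ring
  refine ⟨p * l + r * k, ⟨hm0, by linarith⟩, _,
    ⟨_, hA ha hb (a := p * l / (p * l + r * k)) (b := r * k / (p * l + r * k))
      (by positivity) (by positivity) (by rw [← add_div, div_self hm0.ne']), rfl⟩, _,
    ⟨_, hS hs hu (a := p * (1 - l) / (p * (1 - l) + r * (1 - k)))
      (b := r * (1 - k) / (p * (1 - l) + r * (1 - k)))
      (div_nonneg (mul_nonneg hp (by linarith)) hn0.le)
      (div_nonneg (mul_nonneg hr (by linarith)) hn0.le)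
      (by rw [← add_div, div_self hn0.ne']), rfl⟩, ?_⟩
  rw [hmn]
  have hm := hm0.ne'
  have hn := hn0.ne'
  simp only [smul_add, smul_smul]
  rw [mul_div_cancel₀ _ hm, mul_div_cancel₀ _ hm, mul_div_cancel₀ _ hn, mul_div_cancel₀ _ hn]
  abel

theorem convex_flat {U : Ω → Set (Fin d → ℝ)} (hU : ∀ ω, Convex ℝ (U ω)) (ω : Ω) :
    Convex ℝ (flat ψ t U ω) :=
  convex_iInter₂ fun ω' _ => convex_iUnion_combo (hU ω') (convex_convexHull ℝ _)

theorem flat_eq_of_mem_level (U : Ω → Set (Fin d → ℝ)) {ω ω' : Ω} (h : ω' ∈ level ψ t ω) :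
    flat ψ t U ω' = flat ψ t U ω := by
  simp only [flat, sharp, level_eq_of_mem h]

theorem subset_sharp (U : Ω → Set (Fin d → ℝ)) {ω ω' : Ω} (h : ω' ∈ level ψ t ω) :
    U ω' ⊆ sharp ψ t U ω :=
  (subset_biUnion_of_mem h).trans (subset_convexHull ℝ _)

variable [MeasurableSpace E] {T : ℕ} {V C : ℕ → Ω → Set (Fin d → ℝ)}

theorem IsMSP.V_eq (h : IsMSP ψ T V C) (ht : t ≤ T) {ω ω' : Ω} (hω : ω' ∈ level ψ t ω) :
    V t ω' = V t ω := by
  obtain ⟨hV, -, hP⟩ := h t ht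
  exact (subset_of_closure_eq_of_relatively_open (hP ω).1 (hP ω').2.1 (hP ω).2.1
    (hV.closure_eq hω)).antisymm (subset_of_closure_eq_of_relatively_open (hP ω').1
      (hP ω).2.1 (hP ω').2.1 (hV.closure_eq hω).symm)

theorem IsMSP.C_eq (h : IsMSP ψ T V C) (ht : t ≤ T) {ω ω' : Ω} (hω : ω' ∈ level ψ t ω) :
    C t ω' = C t ω := by
  obtain ⟨-, hC, hP⟩ := h t ht
  rw [← (hP ω).2.2.1.closure_eq, ← (hP ω').2.2.1.closure_eq, hC.closure_eq hω]

theorem IsMSP.convex_Wrev (h : IsMSP ψ T V C) (k : ℕ) (ω : Ω) :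
    Convex ℝ (Wrev ψ T V C k ω) := by
  induction k generalizing ω with
  | zero => exact ((h T le_rfl).2.2 ω).1
  | succ k ih =>
    have hP := (h (T - (k + 1)) (Nat.sub_le _ _)).2.2 ω
    exact hP.1.inter ((convex_flat ih ω).sub hP.2.2.2)

theorem IsMSP.Wrev_eq (h : IsMSP ψ T V C) (k : ℕ) {ω ω' : Ω}
    (hω : ω' ∈ level ψ (T - k) ω) : Wrev ψ T V C k ω' = Wrev ψ T V C k ω := by
  cases k with
  | zero => exact h.V_eq le_rfl hω
  | succ k =>
    simp only [Wrev]
    rw [h.V_eq (Nat.sub_le _ _) hω, h.C_eq (Nat.sub_le _ _) hω, flat_eq_of_mem_level _ hω]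

theorem IsMSP.convex_W (h : IsMSP ψ T V C) (t : ℕ) (ω : Ω) : Convex ℝ (W ψ T V C t ω) :=
  h.convex_Wrev _ ω

theorem IsMSP.W_eq (h : IsMSP ψ T V C) (ht : t ≤ T) {ω ω' : Ω} (hω : ω' ∈ level ψ t ω) :
    W ψ T V C t ω' = W ψ T V C t ω :=
  h.Wrev_eq _ (by rwa [Nat.sub_sub_self ht])

end Flat

section Mixtures

variable {Ω F : Type*} [AddCommGroup F] [Module ℝ F]

theorem FinProb.nonneg (Q : FinProb Ω) (ω : Ω) : 0 ≤ Q.w ω := by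
  by_cases h : ω ∈ Q.supp
  · exact (Q.pos ω h).le
  · exact (Q.zero ω h).ge

theorem FinProb.sum_smul_of_supp_subset (Q : FinProb Ω) {S : Finset Ω} (h : Q.supp ⊆ S)
    (ξ : Ω → F) : ∑ q ∈ S, Q.w q • ξ q = ∑ q ∈ Q.supp, Q.w q • ξ q :=
  (Finset.sum_subset h fun q _ hq => by rw [Q.zero q hq, zero_smul]).symm

/-- Mixing two finitely supported probabilities carrying pointwise selections of a
convex-valued correspondence. -/
theorem exists_finProb_mixture {U : Ω → Set F} (hU : ∀ q, Convex ℝ (U q)) (P Q : FinProb Ω)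
    {ξ η : Ω → F} (hξ : ∀ q, ξ q ∈ U q) (hη : ∀ q, η q ∈ U q) {p r : ℝ} (hp : 0 < p)
    (hr : 0 < r) (hpr : p + r = 1) :
    ∃ (R : FinProb Ω) (ζ : Ω → F), (∀ q, ζ q ∈ U q) ∧
      (R.supp : Set Ω) = (P.supp : Set Ω) ∪ Q.supp ∧
      ∑ q ∈ R.supp, R.w q • ζ q =
        p • ∑ q ∈ P.supp, P.w q • ξ q + r • ∑ q ∈ Q.supp, Q.w q • η q := by
  classical
  have hz : ∀ q, ∃ z ∈ U q, (p * P.w q + r * Q.w q) • z =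
      (p * P.w q) • ξ q + (r * Q.w q) • η q := by
    intro q
    have h1 : 0 ≤ p * P.w q := mul_nonneg hp.le (P.nonneg q)
    have h2 : 0 ≤ r * Q.w q := mul_nonneg hr.le (Q.nonneg q)
    rcases (add_nonneg h1 h2).eq_or_lt with h | h
    · have h1' : p * P.w q = 0 := by linarith
      have h2' : r * Q.w q = 0 := by linarith
      exact ⟨ξ q, hξ q, by simp [h1', h2']⟩
    · refine ⟨_, hU q (hξ q) (hη q) (div_nonneg h1 h.le) (div_nonneg h2 h.le)
        (by rw [← add_div, div_self h.ne']), ?_⟩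
      rw [smul_add, smul_smul, smul_smul, mul_div_cancel₀ _ h.ne', mul_div_cancel₀ _ h.ne']
  choose ζ hζU hζ using hz
  have hP : ∑ q ∈ P.supp ∪ Q.supp, P.w q = 1 := by
    simpa [P.sum_one] using P.sum_smul_of_supp_subset (Finset.subset_union_left (s₂ := Q.supp))
      (fun _ => (1 : ℝ))
  have hQ : ∑ q ∈ P.supp ∪ Q.supp, Q.w q = 1 := by
    simpa [Q.sum_one] using Q.sum_smul_of_supp_subset (Finset.subset_union_right (s₁ := P.supp))
      (fun _ => (1 : ℝ))
  refine ⟨⟨P.supp ∪ Q.supp, fun q => p * P.w q + r * Q.w q, ?_, ?_, ?_⟩, ζ, hζU, by simp, ?_⟩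
  · intro q hq
    rcases Finset.mem_union.1 hq with h | h
    · exact add_pos_of_pos_of_nonneg (mul_pos hp (P.pos q h)) (mul_nonneg hr.le (Q.nonneg q))
    · exact add_pos_of_nonneg_of_pos (mul_nonneg hp.le (P.nonneg q)) (mul_pos hr (Q.pos q h))
  · intro q hq
    rw [Finset.mem_union, not_or] at hq
    rw [P.zero q hq.1, Q.zero q hq.2]
    simp
  · rw [Finset.sum_add_distrib, ← Finset.mul_sum, ← Finset.mul_sum, hP, hQ]
    simpa using hpr
  · simp only [hζ]
    rw [← P.sum_smul_of_supp_subset (Finset.subset_union_left (s₂ := Q.supp)) ξ,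
      ← Q.sum_smul_of_supp_subset (Finset.subset_union_right (s₁ := P.supp)) η,
      Finset.sum_add_distrib, Finset.smul_sum, Finset.smul_sum]
    simp only [smul_smul]

theorem exists_finProb_of_mem_convexHull {U : Ω → Set F} (hU : ∀ q, Convex ℝ (U q))
    (hne : ∀ q, (U q).Nonempty) {R : Set Ω} {x : F} (hx : x ∈ convexHull ℝ (⋃ q ∈ R, U q)) :
    ∃ (Q : FinProb Ω) (ξ : Ω → F), (∀ q, ξ q ∈ U q) ∧ (Q.supp : Set Ω) ⊆ R ∧
      ∑ q ∈ Q.supp, Q.w q • ξ q = x := by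
  classical
  refine convexHull_min (t := {x | ∃ (Q : FinProb Ω) (ξ : Ω → F), (∀ q, ξ q ∈ U q) ∧
    (Q.supp : Set Ω) ⊆ R ∧ ∑ q ∈ Q.supp, Q.w q • ξ q = x}) ?_ ?_ hx
  · intro u hu
    simp only [mem_iUnion, exists_prop] at hu
    obtain ⟨q, hq, hu⟩ := hu
    choose η hη using hne
    refine ⟨FinProb.dirac q, Function.update η q u, fun q' => ?_, by simpa using hq, by simp⟩
    rcases eq_or_ne q' q with rfl | h
    · simpa using hu
    · simpa [h] using hη q'
  · rw [convex_iff_forall_pos]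
    rintro _ ⟨P, ξ, hξ, hP, rfl⟩ _ ⟨Q, η, hη, hQ, rfl⟩ p r hp hr hpr
    obtain ⟨S, ζ, hζ, hS, hsum⟩ := exists_finProb_mixture hU P Q hξ hη hp hr hpr
    exact ⟨S, ζ, hζ, hS ▸ union_subset hP hQ, hsum⟩

end Mixtures

section ConditionalExpectation

variable {Ω E : Type*} {ψ : ℕ → Ω → E} {t : ℕ}

theorem condExp_eq_sum_of_supp_subset_level {F : Type*} [AddCommGroup F] [Module ℝ F]
    {Q : FinProb Ω} {ω : Ω} (hQ : (Q.supp : Set Ω) ⊆ level ψ t ω) (ξ : Ω → F) :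
    condExp ψ t Q ξ ω = ∑ q ∈ Q.supp, Q.w q • ξ q := by
  classical
  have hfilter : ∀ q ∈ Q.supp, q ∈ level ψ t ω := fun q hq => hQ hq
  rw [condExp, FinProb.meas, Finset.filter_true_of_mem hfilter, Q.sum_one, inv_one, one_smul]

theorem condExp_mem_combo {d : ℕ} {U : Ω → Set (Fin d → ℝ)} {Q : FinProb Ω} {ω ω' : Ω}
    (hω' : ω' ∈ level ψ t ω) (hQ : ω' ∈ Q.supp) {ξ : Ω → Fin d → ℝ} (hξ : ∀ q, ξ q ∈ U q) :
    ∃ l ∈ Ioo (0 : ℝ) 1, ∃ s ∈ sharp ψ t U ω,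
      condExp ψ t Q ξ ω = l • ξ ω' + (1 - l) • s := by
  classical
  set S := Q.supp.filter fun q => q ∈ level ψ t ω with hS
  have hmem : ω' ∈ S := Finset.mem_filter.2 ⟨hQ, hω'⟩
  have hle : Q.w ω' ≤ ∑ q ∈ S, Q.w q :=
    Finset.single_le_sum (fun q _ => Q.nonneg q) hmem
  have hpos := Q.pos ω' hQ
  set m := ∑ q ∈ S, Q.w q with hm
  have hm0 : 0 < m := hpos.trans_le hle
  have hl1 : Q.w ω' / m ≤ 1 := (div_le_one hm0).2 hle
  have hl0 : 0 < Q.w ω' / m := by positivity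
  set l := Q.w ω' / m / 2 with hl
  have hl' : 0 < 1 - l := by linarith
  have hcond : condExp ψ t Q ξ ω = ∑ q ∈ S, (Q.w q / m) • ξ q := by
    rw [condExp, FinProb.meas]
    have : ∀ q, Q.w q / m = m⁻¹ * Q.w q := fun q => by rw [div_eq_inv_mul]
    simp only [this, ← smul_smul, ← Finset.smul_sum]
    congr!
  let v : Ω → ℝ := fun q => (Q.w q / m - if q = ω' then l else 0) / (1 - l)
  have hv0 : ∀ q ∈ S, 0 ≤ v q := by
    intro q _
    refine div_nonneg ?_ hl'.le
    split_ifs with h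
    · rw [h]; linarith
    · simpa using div_nonneg (Q.nonneg q) hm0.le
  have hv1 : ∑ q ∈ S, v q = 1 := by
    rw [← Finset.sum_div, Finset.sum_sub_distrib, ← Finset.sum_div, ← hm, div_self hm0.ne',
      Finset.sum_ite_eq' S ω', if_pos hmem, div_self hl'.ne']
  refine ⟨l, ⟨by positivity, by linarith⟩, ∑ q ∈ S, v q • ξ q,
    (convex_convexHull ℝ _).sum_mem hv0 hv1 fun q hq =>
      subset_sharp U (Finset.mem_filter.1 hq).2 (hξ q), ?_⟩
  rw [hcond, Finset.smul_sum]
  have hterm : ∀ q, (1 - l) • v q • ξ q =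
      (Q.w q / m) • ξ q - if q = ω' then l • ξ q else 0 := by
    intro q
    rw [smul_smul, mul_div_cancel₀ _ hl'.ne', sub_smul, ite_smul, zero_smul]
  simp only [hterm]
  rw [Finset.sum_sub_distrib, Finset.sum_ite_eq' S ω', if_pos hmem]
  abel

/-- A map choosing one representative in each level set, with a prescribed fixed point. -/
theorem exists_level_representative (ψ : ℕ → Ω → E) (t : ℕ) (ω' : Ω) :
    ∃ ρ : Ω → Ω, ρ ω' = ω' ∧ (∀ q, ρ q ∈ level ψ t q) ∧
      ∀ q, ∀ q' ∈ level ψ t q, ρ q' = ρ q := by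
  classical
  have hne : ∀ A : Set Ω, ∃ a, A.Nonempty → a ∈ A := fun A => by
    by_cases h : A.Nonempty
    · exact ⟨h.some, fun _ => h.some_mem⟩
    · exact ⟨ω', fun h' => absurd h' h⟩
  choose c hc using hne
  refine ⟨fun q => if ω' ∈ level ψ t q then ω' else c (level ψ t q), ?_, ?_, ?_⟩
  · exact if_pos (mem_level_self ψ t ω')
  · intro q
    dsimp only
    split_ifs with h
    · exact h
    · exact hc _ ⟨q, mem_level_self ψ t q⟩
  · intro q q' h
    simp only [level_eq_of_mem h]

end ConditionalExpectation

/-- Lemma 4.12: characterization of `W_{t+1}^♭ − C_t`. -/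
theorem flatW_sub_C_characterization
    {Ω E : Type*}
    [TopologicalSpace Ω] [PolishSpace Ω] [MeasurableSpace Ω] [BorelSpace Ω]
    [MetricSpace E] [TopologicalSpace.SeparableSpace E] [MeasurableSpace E] [BorelSpace E]
    (ψ : ℕ → Ω → E) (hψ : ∀ t, Measurable (ψ t)) (hψ0 : ∃ e : E, ∀ ω, ψ 0 ω = e)
    (d T : ℕ) (V C : ℕ → Ω → Set (Fin d → ℝ)) (hMSP : IsMSP ψ T V C)
    (t : ℕ) (ht : t < T)
    (hW : ∀ ω : Ω, (W ψ T V C (t + 1) ω).Nonempty) (ω : Ω) :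
    flat ψ t (W ψ T V C (t + 1)) ω - C t ω =
      {y : Fin d → ℝ | ∀ ω' ∈ level ψ t ω,
        ∃ ξ ∈ Selections (filt ψ (t + 1)) (W ψ T V C (t + 1)),
          ∃ Q : FinProb Ω, ω' ∈ Q.supp ∧ condExp ψ t Q ξ ω - y ∈ C t ω} := by
  set U := W ψ T V C (t + 1)
  have hconv : ∀ q, Convex ℝ (U q) := hMSP.convex_W (t + 1)
  have hlev : ∀ q, ∀ q' ∈ level ψ (t + 1) q, U q' = U q := fun q q' h => hMSP.W_eq ht h
  apply Subset.antisymm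
  · rintro _ ⟨a, ha, c, hc, rfl⟩ ω' hω'
    have ha' := mem_iInter₂.1 ha ω' hω'
    simp only [mem_iUnion, exists_prop, mem_add, mem_smul_set] at ha'
    obtain ⟨l, ⟨hl0, hl1⟩, _, ⟨u, hu, rfl⟩, _, ⟨s, hs, rfl⟩, rfl⟩ := ha'
    obtain ⟨ρ, hρω', hρ, hρc⟩ := exists_level_representative ψ (t + 1) ω'
    have hρρ : ∀ q, ρ (ρ q) = ρ q := fun q => hρc q _ (hρ q)
    set R : Set Ω := {q | q ∈ level ψ t ω ∧ ρ q = q}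
    have hsub : (⋃ q ∈ level ψ t ω, U q) ⊆ ⋃ q ∈ R, U q := by
      refine iUnion₂_subset fun q hq => ?_
      rw [← hlev q _ (hρ q)]
      refine subset_biUnion_of_mem (u := U) (x := ρ q) ⟨?_, hρρ q⟩
      rw [← level_eq_of_mem hq]
      exact level_succ_subset ψ t q (hρ q)
    have hω'R : ω' ∈ R := ⟨hω', hρω'⟩
    obtain ⟨P, ξ, hξ, hP, rfl⟩ := exists_finProb_of_mem_convexHull hconv hW
      (R := {ω'}) (x := u) (subset_convexHull ℝ _ (by simpa using hu))
    obtain ⟨Q, η, hη, hQ, rfl⟩ := exists_finProb_of_mem_convexHull hconv hW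
      (convexHull_mono hsub hs)
    obtain ⟨S, ζ, hζ, hS, hsum⟩ :=
      exists_finProb_mixture hconv P Q hξ hη hl0 (sub_pos.2 hl1) (by ring)
    have hPne : ω' ∈ P.supp := by
      obtain ⟨q, hq⟩ : P.supp.Nonempty := by
        rw [Finset.nonempty_iff_ne_empty]
        intro h
        simpa [h] using P.sum_one
      rwa [← mem_singleton_iff.1 (hP hq)]
    have hSR : (S.supp : Set Ω) ⊆ R := by
      rw [hS]
      exact union_subset (hP.trans (by simpa using hω'R)) hQ
    refine ⟨ζ ∘ ρ, ⟨measurable_filt_of_forall_level fun q q' h => ?_, fun q => ?_⟩, S, ?_, ?_⟩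
    · simp only [Function.comp_apply, hρc q q' h]
    · rw [← hlev q _ (hρ q)]
      exact hζ _
    · rw [← Finset.mem_coe, hS]
      exact Or.inl hPne
    · rw [condExp_eq_sum_of_supp_subset_level fun q hq => (hSR hq).1,
        Finset.sum_congr rfl (g := fun q => S.w q • ζ q) fun q hq => by
          rw [Function.comp_apply, (hSR hq).2], hsum]
      simpa using hc
  · intro y hy
    have hCconv : Convex ℝ (C t ω) := ((hMSP t ht.le).2.2 ω).2.2.2
    set K : Set (Fin d → ℝ) := (fun a => a - y) ⁻¹' C t ω ∩ sharp ψ t U ω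
    have hK : Convex ℝ K := by
      refine Convex.inter ?_ (convex_convexHull ℝ _)
      simpa only [sub_eq_add_neg] using hCconv.translate_preimage_left (-y)
    have hpoint : ∀ ω' ∈ level ψ t ω, ∃ l ∈ Ioo (0 : ℝ) 1, ∃ u ∈ U ω', ∃ s ∈ sharp ψ t U ω,
        l • u + (1 - l) • s ∈ K := by
      intro ω' hω'
      obtain ⟨ξ, hξ, Q, hQ, hmem⟩ := hy ω' hω'
      obtain ⟨l, hl, s, hs, heq⟩ := condExp_mem_combo hω' hQ hξ.2
      refine ⟨l, hl, ξ ω', hξ.2 ω', s, hs, by rwa [heq] at hmem, ?_⟩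
      exact convex_convexHull ℝ _ (subset_sharp U hω' (hξ.2 ω')) hs hl.1.le
        (sub_pos.2 hl.2).le (by ring)
    have hKne : K.Nonempty := by
      obtain ⟨l, -, u, -, s, -, h⟩ := hpoint ω (mem_level_self ψ t ω)
      exact ⟨_, h⟩
    obtain ⟨a, ha⟩ := hKne.intrinsicInterior hK
    refine ⟨a, mem_iInter₂.2 fun ω' hω' => ?_, a - y, (intrinsicInterior_subset ha).1, by simp⟩
    obtain ⟨l, ⟨hl0, hl1⟩, u, hu, s, hs, hb⟩ := hpoint ω' hω'
    obtain ⟨μ, ⟨hμ0, hμ1⟩, b, hbK, rfl⟩ :=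
      exists_extension_of_mem_intrinsicInterior ha (subset_affineSpan ℝ K hb)
    have hμl : μ * l < 1 := by nlinarith
    have hne : 1 - μ * l ≠ 0 := (sub_pos.2 hμl).ne'
    simp only [mem_iUnion, exists_prop, mem_add, mem_smul_set]
    refine ⟨μ * l, ⟨mul_pos hμ0 hl0, hμl⟩, _, ⟨u, hu, rfl⟩, _,
      ⟨_, convex_convexHull ℝ _ hs hbK.2 (a := μ * (1 - l) / (1 - μ * l))
        (b := (1 - μ) / (1 - μ * l))
        (div_nonneg (mul_nonneg hμ0.le (sub_pos.2 hl1).le) (sub_pos.2 hμl).le)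
        (div_nonneg (sub_pos.2 hμ1).le (sub_pos.2 hμl).le)
        (by field_simp; ring), rfl⟩, ?_⟩
    simp only [smul_add, smul_smul]
    rw [mul_div_cancel₀ _ hne, mul_div_cancel₀ _ hne]
    abel

end MSPPaper
end

section
/- Let (Ω,G) be a measurable space, let A, B : Ω ⇒ ℝ^d be G-measurable correspondences with closed values, and let ζ : Ω → ℝ^d be a G-measurable map with ζ(ω) ∈ A(ω) + B(ω) for every ω ∈ Ω. Then there exist G-measurable maps η, θ : Ω → ℝ^d with η(ω) ∈ A(ω), θ(ω) ∈ B(ω) and ζ(ω) = η(ω) + θ(ω) for every ω ∈ Ω. -/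
open Set Pointwise

namespace MSPPaper

open Filter Topology Metric

section Selection

variable {Ω X : Type*} [MeasurableSpace Ω]

/-- A correspondence with nonempty closed values whose lower inverses of compact sets are
measurable. -/
structure IsCompactMeasurable [TopologicalSpace X] (C : Ω → Set X) : Prop where
  nonempty : ∀ ω, (C ω).Nonempty
  isClosed : ∀ ω, IsClosed (C ω)
  measurableSet : ∀ K, IsCompact K → MeasurableSet {ω | (C ω ∩ K).Nonempty}

variable [MetricSpace X]

/-- The distance from a fixed point to a measurable correspondence is measurable. -/
theorem measurable_infDist_of_measurableSet_inter {A : Ω → Set X}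
    (hA : ∀ O, IsOpen O → MeasurableSet {ω | (A ω ∩ O).Nonempty}) (hne : ∀ ω, (A ω).Nonempty)
    (x : X) : Measurable fun ω => infDist x (A ω) := by
  refine measurable_of_Iio fun r => ?_
  convert hA (ball x r) isOpen_ball using 1
  ext ω
  simp [infDist_lt_iff (hne ω), Set.Nonempty, dist_comm]

variable [ProperSpace X]

/-- A compactly measurable correspondence can be shrunk to have values of radius at most `ε`,
around a measurable center. -/
theorem IsCompactMeasurable.exists_subset_closedBall [MeasurableSpace X]
    {C : Ω → Set X} (hC : IsCompactMeasurable C) {ε : ℝ} (hε : 0 < ε) :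
    ∃ (y : Ω → X) (C' : Ω → Set X), Measurable y ∧ IsCompactMeasurable C' ∧
      ∀ ω, C' ω ⊆ C ω ∩ closedBall (y ω) ε := by
  classical
  rcases isEmpty_or_nonempty X with hX | hX
  · have : IsEmpty Ω := ⟨fun ω => hX.elim (hC.nonempty ω).some⟩
    exact ⟨fun ω => isEmptyElim ω, C, measurable_of_empty _, hC, fun ω => isEmptyElim ω⟩
  let x := TopologicalSpace.denseSeq X
  have hex : ∀ ω, ∃ k, (C ω ∩ closedBall (x k) ε).Nonempty := by
    intro ω
    obtain ⟨c, hc⟩ := hC.nonempty ω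
    obtain ⟨k, hk⟩ := (TopologicalSpace.denseRange_denseSeq X).exists_dist_lt c hε
    exact ⟨k, c, hc, hk.le⟩
  have hN : Measurable fun ω => Nat.find (hex ω) :=
    measurable_find hex fun k => hC.measurableSet _ (isCompact_closedBall _ _)
  refine ⟨fun ω => x (Nat.find (hex ω)), fun ω => C ω ∩ closedBall (x (Nat.find (hex ω))) ε,
    (measurable_of_countable x).comp hN, ⟨fun ω => Nat.find_spec (hex ω),
      fun ω => (hC.isClosed ω).inter isClosed_closedBall, fun K hK => ?_⟩, fun ω => Subset.rfl⟩
  have : {ω | (C ω ∩ closedBall (x (Nat.find (hex ω))) ε ∩ K).Nonempty} =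
      ⋃ k, (fun ω => Nat.find (hex ω)) ⁻¹' {k} ∩
        {ω | (C ω ∩ (closedBall (x k) ε ∩ K)).Nonempty} := by
    ext ω
    simp [inter_assoc]
  rw [this]
  exact MeasurableSet.iUnion fun k => (hN (measurableSet_singleton k)).inter
    (hC.measurableSet _ ((isCompact_closedBall _ _).inter_right hK.isClosed))

/-- **Kuratowski–Ryll-Nardzewski selection theorem** in a proper metric space. -/
theorem IsCompactMeasurable.exists_measurable_selection [MeasurableSpace X] [BorelSpace X]
    {C : Ω → Set X} (hC : IsCompactMeasurable C) :
    ∃ η : Ω → X, Measurable η ∧ ∀ ω, η ω ∈ C ω := by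
  have step (D : {D : Ω → Set X // IsCompactMeasurable D}) (n : ℕ) :
      ∃ (y : Ω → X) (D' : {D : Ω → Set X // IsCompactMeasurable D}), Measurable y ∧
        ∀ ω, D'.1 ω ⊆ D.1 ω ∩ closedBall (y ω) (1 / ((n : ℝ) + 1)) := by
    obtain ⟨y, D', hy, hD', h⟩ := D.2.exists_subset_closedBall (Nat.one_div_pos_of_nat (n := n))
    exact ⟨y, ⟨D', hD'⟩, hy, h⟩
  choose y nextC hy hnextC using step
  let s : ℕ → {D : Ω → Set X // IsCompactMeasurable D} :=
    fun n => Nat.rec ⟨C, hC⟩ (fun n D => nextC D n) n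
  have hs (n : ℕ) (ω : Ω) :
      (s (n + 1)).1 ω ⊆ (s n).1 ω ∩ closedBall (y (s n) n ω) (1 / ((n : ℝ) + 1)) :=
    hnextC (s n) n ω
  have hne (ω : Ω) : (⋂ n, (s (n + 1)).1 ω).Nonempty :=
    IsCompact.nonempty_iInter_of_sequence_nonempty_isCompact_isClosed _
      (fun n => (hs (n + 1) ω).trans inter_subset_left) (fun n => (s (n + 1)).2.nonempty ω)
      ((isCompact_closedBall _ _).of_isClosed_subset ((s 1).2.isClosed ω)
        ((hs 0 ω).trans inter_subset_right)) (fun n => (s (n + 1)).2.isClosed ω)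
  choose η hη using hne
  have hη' (ω : Ω) (n : ℕ) := hs n ω (mem_iInter.1 (hη ω) n)
  refine ⟨η, measurable_of_tendsto_metrizable (fun n => hy (s n) n) ?_, fun ω => (hη' ω 0).1⟩
  refine tendsto_pi_nhds.2 fun ω => tendsto_iff_dist_tendsto_zero.2 ?_
  exact squeeze_zero (fun _ => dist_nonneg) (fun n => by rw [dist_comm]; exact (hη' ω n).2)
    tendsto_one_div_add_atTop_nhds_zero_nat

/-- The zero set of a nonnegative Carathéodory function hits each compact set measurably. -/
theorem measurableSet_exists_eq_zero {f : Ω → X → ℝ} (hf : ∀ x, Measurable fun ω => f ω x)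
    (hcont : ∀ ω, Continuous (f ω)) (hnonneg : ∀ ω x, 0 ≤ f ω x) {K : Set X} (hK : IsCompact K) :
    MeasurableSet {ω | ({x | f ω x = 0} ∩ K).Nonempty} := by
  obtain ⟨t, htK, ht, hKt⟩ :=
    (TopologicalSpace.IsSeparable.of_separableSpace K).exists_countable_dense_subset
  have : {ω | ({x | f ω x = 0} ∩ K).Nonempty} =
      ⋂ n : ℕ, ⋃ q ∈ t, {ω | f ω q < 1 / ((n : ℝ) + 1)} := by
    ext ω
    simp only [mem_ofPred_eq, mem_iInter, mem_iUnion, exists_prop]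
    constructor
    · rintro ⟨x, hx, hxK⟩ n
      have hopen : IsOpen {z | f ω z < 1 / ((n : ℝ) + 1)} :=
        isOpen_lt (hcont ω) continuous_const
      obtain ⟨q, hq, hqt⟩ := mem_closure_iff.1 (hKt hxK) _ hopen (by
        rw [mem_ofPred_eq, show f ω x = 0 from hx]; exact Nat.one_div_pos_of_nat)
      exact ⟨q, hqt, hq⟩
    · intro h
      obtain ⟨q₀, hq₀, -⟩ := h 0
      obtain ⟨x, hxK, hx⟩ := hK.exists_isMinOn ⟨q₀, htK hq₀⟩ (hcont ω).continuousOn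
      refine ⟨x, le_antisymm ?_ (hnonneg ω x), hxK⟩
      refine ge_of_tendsto' tendsto_one_div_add_atTop_nhds_zero_nat fun n => ?_
      obtain ⟨q, hq, hlt⟩ := h n
      exact (hx (htK hq)).trans hlt.le
  rw [this]
  exact MeasurableSet.iInter fun n => MeasurableSet.biUnion ht fun q _ =>
    measurableSet_lt (hf q) measurable_const

end Selection

/-- Lemma A.1: a measurable selection of a Minkowski sum of two measurable
closed-valued correspondences decomposes into measurable selections of the
summands. -/
theorem measurable_sum_decomposition
    {Ω : Type*} [MeasurableSpace Ω] (d : ℕ)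
    (A B : Ω → Set (Fin d → ℝ))
    (hAmeas : ∀ O : Set (Fin d → ℝ), IsOpen O → MeasurableSet {ω | (A ω ∩ O).Nonempty})
    (hBmeas : ∀ O : Set (Fin d → ℝ), IsOpen O → MeasurableSet {ω | (B ω ∩ O).Nonempty})
    (hAclosed : ∀ ω, IsClosed (A ω)) (hBclosed : ∀ ω, IsClosed (B ω))
    (ζ : Ω → (Fin d → ℝ)) (hζ : Measurable ζ) (hmem : ∀ ω, ζ ω ∈ A ω + B ω) :
    ∃ η θ : Ω → (Fin d → ℝ), Measurable η ∧ Measurable θ ∧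
      ∀ ω, η ω ∈ A ω ∧ θ ω ∈ B ω ∧ ζ ω = η ω + θ ω := by
  have hsum (ω : Ω) : ∃ a ∈ A ω, ∃ b ∈ B ω, a + b = ζ ω := mem_add.1 (hmem ω)
  have hA (ω : Ω) : (A ω).Nonempty := let ⟨a, ha, _⟩ := hsum ω; ⟨a, ha⟩
  have hB (ω : Ω) : (B ω).Nonempty := let ⟨_, _, b, hb, _⟩ := hsum ω; ⟨b, hb⟩
  let f : Ω → (Fin d → ℝ) → ℝ := fun ω x => infDist x (A ω) + infDist (ζ ω - x) (B ω)
  have hf_zero (ω : Ω) (x : Fin d → ℝ) : f ω x = 0 ↔ x ∈ A ω ∧ ζ ω - x ∈ B ω := by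
    rw [(hAclosed ω).mem_iff_infDist_zero (hA ω), (hBclosed ω).mem_iff_infDist_zero (hB ω)]
    exact add_eq_zero_iff_of_nonneg infDist_nonneg infDist_nonneg
  have hf_cont (ω : Ω) : Continuous (f ω) :=
    (continuous_infDist_pt _).add
      ((continuous_infDist_pt _).comp (continuous_const.sub continuous_id))
  have hf_meas (x : Fin d → ℝ) : Measurable fun ω => f ω x := by
    have hjoint : Measurable (Function.uncurry fun (z : Fin d → ℝ) ω => infDist z (B ω)) :=
      MeasureTheory.measurable_uncurry_of_continuous_of_measurable
        (fun ω => continuous_infDist_pt _)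
        (measurable_infDist_of_measurableSet_inter hBmeas hB)
    have hζx : Measurable fun ω => (ζ ω - x, ω) := (hζ.sub_const x).prodMk measurable_id
    have hdistB : Measurable fun ω => infDist (ζ ω - x) (B ω) := by
      simpa only [Function.comp_def, Function.uncurry_apply_pair] using hjoint.comp hζx
    exact (measurable_infDist_of_measurableSet_inter hAmeas hA x).add hdistB
  have hC : IsCompactMeasurable fun ω => {x | f ω x = 0} :=
    { nonempty := fun ω => by
        obtain ⟨a, ha, b, hb, hab⟩ := hsum ω
        exact ⟨a, (hf_zero ω a).2 ⟨ha, by rwa [← hab, add_sub_cancel_left]⟩⟩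
      isClosed := fun ω => isClosed_eq (hf_cont ω) continuous_const
      measurableSet := fun K hK => measurableSet_exists_eq_zero hf_meas hf_cont
        (fun ω x => add_nonneg infDist_nonneg infDist_nonneg) hK }
  obtain ⟨η, hη, hηC⟩ := hC.exists_measurable_selection
  refine ⟨η, fun ω => ζ ω - η ω, hη, hζ.sub hη, fun ω => ?_⟩
  obtain ⟨h₁, h₂⟩ := (hf_zero ω (η ω)).1 (hηC ω)
  exact ⟨h₁, h₂, (add_sub_cancel _ _).symm⟩

end MSPPaper
end

section
/- Let (Ω,G) be a measurable space and let U : Ω ⇒ ℝ^k be a G-measurable correspondence with nonempty convex values (not necessarily closed). Then there exists a G-measurable map ζ : Ω → ℝ^k with ζ(ω) ∈ ri U(ω) for every ω ∈ Ω. -/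
open Set

namespace MSPPaper

open Metric Filter Topology TopologicalSpace

section Selection

variable {Ω X : Type*} [MeasurableSpace Ω] [MetricSpace X]

/-- If an approximate selection of `U` along a dense sequence `D` has error less than `r`, it can be
refined to one with error less than `s`, moving each value by less than `r + s`. -/
lemma exists_measurable_refinement {D : ℕ → X} (hD : DenseRange D) {U : Ω → Set X}
    (hU : ∀ O : Set X, IsOpen O → MeasurableSet {ω | (U ω ∩ O).Nonempty})
    {g : Ω → ℕ} (hg : Measurable g) {r s : ℝ} (hs : 0 < s)
    (hgU : ∀ ω, (U ω ∩ ball (D (g ω)) r).Nonempty) :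
    ∃ g' : Ω → ℕ, Measurable g' ∧ (∀ ω, (U ω ∩ ball (D (g' ω)) s).Nonempty) ∧
      ∀ ω, dist (D (g ω)) (D (g' ω)) < r + s := by
  classical
  have hex : ∀ ω, ∃ j, (U ω ∩ (ball (D (g ω)) r ∩ ball (D j) s)).Nonempty := by
    intro ω
    obtain ⟨x, hxU, hxr⟩ := hgU ω
    obtain ⟨j, hj⟩ := hD.exists_dist_lt x hs
    exact ⟨j, x, hxU, hxr, hj⟩
  refine ⟨fun ω => Nat.find (hex ω), measurable_find hex fun j => ?_, fun ω => ?_, fun ω => ?_⟩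
  · have : {ω | (U ω ∩ (ball (D (g ω)) r ∩ ball (D j) s)).Nonempty} =
        ⋃ i, g ⁻¹' {i} ∩ {ω | (U ω ∩ (ball (D i) r ∩ ball (D j) s)).Nonempty} := by
      ext ω
      simp
    rw [this]
    exact .iUnion fun i => (hg (measurableSet_singleton i)).inter
      (hU _ (isOpen_ball.inter isOpen_ball))
  · obtain ⟨x, hxU, -, hx⟩ := Nat.find_spec (hex ω)
    exact ⟨x, hxU, hx⟩
  · obtain ⟨x, -, hx, hx'⟩ := Nat.find_spec (hex ω)
    exact (dist_triangle_left _ _ x).trans_lt (add_lt_add hx hx')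

/-- **Kuratowski–Ryll-Nardzewski**: the closure of a measurable correspondence with nonempty values
in a Polish space has a measurable selection. -/
lemma exists_measurable_selection_closure [CompleteSpace X] [SeparableSpace X] [Nonempty X]
    [MeasurableSpace X] [BorelSpace X] {U : Ω → Set X}
    (hU : ∀ O : Set X, IsOpen O → MeasurableSet {ω | (U ω ∩ O).Nonempty})
    (hne : ∀ ω, (U ω).Nonempty) :
    ∃ f : Ω → X, Measurable f ∧ ∀ ω, f ω ∈ closure (U ω) := by
  classical
  have hD := denseRange_denseSeq X
  set D := denseSeq X
  have hpos : ∀ n : ℕ, (0 : ℝ) < (1 / 2) ^ n := fun n => by positivity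
  have hex : ∀ ω, ∃ j, (U ω ∩ ball (D j) ((1 / 2 : ℝ) ^ 0)).Nonempty := fun ω => by
    obtain ⟨x, hx⟩ := hne ω
    obtain ⟨j, hj⟩ := hD.exists_dist_lt x (hpos 0)
    exact ⟨j, x, hx, hj⟩
  choose! next hnext_meas hnext_mem hnext_dist using
    fun (n : ℕ) (g : Ω → ℕ)
      (h : Measurable g ∧ ∀ ω, (U ω ∩ ball (D (g ω)) ((1 / 2 : ℝ) ^ n)).Nonempty) =>
    exists_measurable_refinement hD hU h.1 (hpos (n + 1)) h.2
  let g : ℕ → Ω → ℕ := fun n => Nat.rec (fun ω => Nat.find (hex ω)) next n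
  have hg : ∀ n, Measurable (g n) ∧
      ∀ ω, (U ω ∩ ball (D (g n ω)) ((1 / 2 : ℝ) ^ n)).Nonempty := by
    intro n
    induction n with
    | zero => exact ⟨measurable_find hex fun j => hU _ isOpen_ball, fun ω => Nat.find_spec (hex ω)⟩
    | succ n ih => exact ⟨hnext_meas n _ ih, hnext_mem n _ ih⟩
  have hdist : ∀ ω n, dist (D (g n ω)) (D (g (n + 1) ω)) ≤ 2 * (1 / 2 : ℝ) ^ n := by
    intro ω n
    have := hnext_dist n _ (hg n) ω
    refine this.le.trans ?_
    rw [pow_succ]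
    linarith [hpos n]
  choose f hf using fun ω =>
    cauchySeq_tendsto_of_complete (cauchySeq_of_le_geometric _ _ (by norm_num) (hdist ω))
  refine ⟨f, measurable_of_tendsto_metrizable (f := fun n ω => D (g n ω))
    (fun n => measurable_from_nat.comp (hg n).1) (tendsto_pi_nhds.2 hf), fun ω => ?_⟩
  choose x hxU hx using fun n => (hg n).2 ω
  have hx0 : Tendsto (fun n => dist (D (g n ω)) (x n)) atTop (𝓝 0) :=
    squeeze_zero (fun _ => dist_nonneg) (fun n => (mem_ball'.1 (hx n)).le)
      (tendsto_pow_atTop_nhds_zero_of_lt_one (by norm_num) (by norm_num))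
  exact mem_closure_of_tendsto ((tendsto_iff_of_dist hx0).1 (hf ω)) (.of_forall hxU)

/-- **Castaing representation**: a measurable correspondence with nonempty values in a Polish space
admits a sequence of measurable selections of its closure that is pointwise dense in it. -/
lemma exists_castaing_representation [CompleteSpace X] [SeparableSpace X] [Nonempty X]
    [MeasurableSpace X] [BorelSpace X] {U : Ω → Set X}
    (hU : ∀ O : Set X, IsOpen O → MeasurableSet {ω | (U ω ∩ O).Nonempty})
    (hne : ∀ ω, (U ω).Nonempty) :
    ∃ f : ℕ → Ω → X, (∀ n, Measurable (f n)) ∧ (∀ n ω, f n ω ∈ closure (U ω)) ∧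
      ∀ ω, U ω ⊆ closure (range fun n => f n ω) := by
  classical
  have key : ∀ B : Set X, IsOpen B → ∃ f : Ω → X, Measurable f ∧ (∀ ω, f ω ∈ closure (U ω)) ∧
      ∀ ω, (U ω ∩ B).Nonempty → f ω ∈ closure B := by
    intro B hB
    let V : Ω → Set X := fun ω => if (U ω ∩ B).Nonempty then U ω ∩ B else U ω
    obtain ⟨f, hfm, hf⟩ := exists_measurable_selection_closure (U := V) (fun O hO => by
        have : {ω | (V ω ∩ O).Nonempty} = {ω | (U ω ∩ (B ∩ O)).Nonempty} ∪
            ({ω | (U ω ∩ B).Nonempty}ᶜ ∩ {ω | (U ω ∩ O).Nonempty}) := by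
          ext ω
          by_cases h : (U ω ∩ B).Nonempty
          · simp [V, h, inter_assoc]
          · have h' : ¬ (U ω ∩ (B ∩ O)).Nonempty := fun h' =>
              h (h'.mono (inter_subset_inter_right _ inter_subset_left))
            simp [V, h, h']
        rw [this]
        exact (hU _ (hB.inter hO)).union ((hU _ hB).compl.inter (hU _ hO)))
      (fun ω => by
        by_cases h : (U ω ∩ B).Nonempty
        · simp [V, h]
        · simpa [V, h] using hne ω)
    refine ⟨f, hfm, fun ω => closure_mono ?_ (hf ω), fun ω h => closure_mono ?_ (hf ω)⟩
    · by_cases h : (U ω ∩ B).Nonempty <;> simp [V, h]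
    · simp [V, h]
  choose f hfm hfU hfB using
    fun p : ℕ × ℕ => key (ball (denseSeq X p.1) (1 / (p.2 + 1))) isOpen_ball
  refine ⟨fun n => f n.unpair, fun n => hfm _, fun n => hfU _, fun ω x hx => ?_⟩
  refine Metric.mem_closure_range_iff.2 fun ε hε => ?_
  obtain ⟨m, hm⟩ := exists_nat_one_div_lt (half_pos hε)
  obtain ⟨q, hq⟩ := (denseRange_denseSeq X).exists_dist_lt x (Nat.one_div_pos_of_nat (n := m))
  have h := closure_ball_subset_closedBall (hfB (q, m) ω ⟨x, hx, hq⟩)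
  refine ⟨Nat.pair q m, ?_⟩
  simp only [Nat.unpair_pair]
  rw [mem_closedBall] at h
  simp only at h
  linarith [dist_triangle_right x (f (q, m) ω) (denseSeq X q)]

end Selection

section Convex

variable {E : Type*} [NormedAddCommGroup E] [NormedSpace ℝ E]

/-- A countable convex combination, with positive weights, of a dense sequence of points of the
closure of a convex set with nonempty interior lies in the interior. -/
lemma mem_interior_of_hasSum_smul {s : Set E} (hs : Convex ℝ s)
    (hint : (interior s).Nonempty) {z : ℕ → E} (hz : ∀ n, z n ∈ closure s)
    (hdense : s ⊆ closure (range z)) {w : ℕ → ℝ} (hw : ∀ n, 0 < w n) (hw1 : HasSum w 1) {x : E}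
    (hx : HasSum (fun n => w n • z n) x) : x ∈ interior s := by
  by_contra hxs
  obtain ⟨l, hl⟩ := geometric_hahn_banach_open_point hs.interior isOpen_interior hxs
  have hle : ∀ n, l (z n) ≤ l x := fun n => by
    have h := hz n
    rw [← hs.closure_interior_eq_closure_of_nonempty_interior hint] at h
    exact closure_minimal (fun a ha => (hl a ha).le)
      (isClosed_le l.continuous continuous_const) h
  obtain ⟨a, ha⟩ := hint
  obtain ⟨_, hi, i, rfl⟩ :=
    mem_closure_iff.1 (hdense (interior_subset ha)) _ isOpen_interior ha
  have h1 : HasSum (fun n => w n * l (z n)) (l x) := by simpa using hx.mapL l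
  have h2 : HasSum (fun n => w n * l x) (l x) := by simpa using hw1.mul_right (l x)
  exact (hasSum_lt (fun n => mul_le_mul_of_nonneg_left (hle n) (hw n).le)
    (mul_lt_mul_of_pos_left (hl _ hi) (hw i)) h1 h2).false

/-- A countable convex combination, with positive weights, of a dense sequence of points of the
closure of a nonempty convex set lies in the relative interior. -/
lemma mem_intrinsicInterior_of_hasSum_smul [FiniteDimensional ℝ E] {s : Set E} (hs : Convex ℝ s)
    (hne : s.Nonempty) {z : ℕ → E} (hz : ∀ n, z n ∈ closure s)
    (hdense : s ⊆ closure (range z)) {w : ℕ → ℝ} (hw : ∀ n, 0 < w n) (hw1 : HasSum w 1) {x : E}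
    (hx : HasSum (fun n => w n • z n) x) : x ∈ intrinsicInterior ℝ s := by
  obtain ⟨p, hp⟩ := hne
  have hpA : p ∈ affineSpan ℝ s := subset_affineSpan _ _ hp
  have : Nonempty (affineSpan ℝ s) := ⟨⟨p, hpA⟩⟩
  let V := (affineSpan ℝ s).direction
  let φ : V →ᵃⁱ[ℝ] E := (affineSpan ℝ s).subtypeₐᵢ.comp
    (AffineIsometryEquiv.vaddConst ℝ (⟨p, hpA⟩ : affineSpan ℝ s)).toAffineIsometry
  have hφ : ∀ v, φ v = (v : E) + p := fun v => rfl
  have hrange : ∀ y ∈ affineSpan ℝ s, ∃ v, φ v = y := fun y hy =>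
    ⟨⟨y - p, AffineSubspace.vsub_mem_direction hy hpA⟩, by simp [hφ]⟩
  have himage : φ '' (φ ⁻¹' s) = s := image_preimage_eq_of_subset fun y hy =>
    hrange y (subset_affineSpan _ _ hy)
  have hconv : Convex ℝ (φ ⁻¹' s) := hs.affine_preimage φ.toAffineMap
  have hint : (interior (φ ⁻¹' s)).Nonempty := by
    rw [hconv.interior_nonempty_iff_affineSpan_eq_top, eq_top_iff]
    intro v _
    have hmap : (affineSpan ℝ (φ ⁻¹' s)).map φ.toAffineMap = affineSpan ℝ s := by
      rw [AffineSubspace.map_span]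
      exact congrArg _ himage
    have hv : φ v ∈ (affineSpan ℝ (φ ⁻¹' s)).map φ.toAffineMap := by
      rw [hmap, hφ]
      exact AffineSubspace.vadd_mem_of_mem_direction v.2 hpA
    obtain ⟨v', hv', h⟩ := hv
    exact φ.injective h ▸ hv'
  have hclosed : IsClosed (affineSpan ℝ s : Set E) := AffineSubspace.closed_of_finiteDimensional _
  choose y hy using fun n =>
    hrange (z n) (closure_minimal (subset_affineSpan ℝ s) hclosed (hz n))
  have hclosure : ∀ t : Set E, t ⊆ range φ → φ ⁻¹' closure t = closure (φ ⁻¹' t) := by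
    intro t ht
    rw [φ.isometry.isEmbedding.isInducing.closure_eq_preimage_closure_image,
      image_preimage_eq_of_subset ht]
  have hsum : HasSum (fun n => w n • (y n : E)) (x - p) := by
    have := hx.sub (hw1.smul_const p)
    simpa [← hy, hφ] using this
  have hxV : x - p ∈ V :=
    V.closed_of_finiteDimensional.mem_of_tendsto hsum
      (.of_forall fun F => V.sum_mem fun n _ => V.smul_mem _ (y n).2)
  have hsumV : HasSum (fun n => w n • y n) (⟨x - p, hxV⟩ : V) := by
    rw [HasSum, tendsto_subtype_rng]
    simpa [HasSum] using hsum
  have hmem := mem_interior_of_hasSum_smul hconv hint (z := y) (fun n => ?_) (fun v hv => ?_)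
    hw hw1 hsumV
  · rw [← himage, φ.intrinsicInterior_image]
    exact ⟨_, interior_subset_intrinsicInterior hmem, by simp [hφ]⟩
  · rw [← hclosure s (himage ▸ image_subset_range _ _), mem_preimage, hy]
    exact hz n
  · have hpre : φ ⁻¹' range z = range y := by
      have : range z = φ '' range y := by
        rw [← range_comp]
        exact congrArg range (funext fun n => (hy n).symm)
      rw [this, φ.injective.preimage_image]
    rw [← hpre, ← hclosure _ (range_subset_iff.2 fun n => ⟨y n, hy n⟩)]
    exact hdense hv

end Convex

/-- Lemma A.2: a measurable correspondence with nonempty convex values (not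
necessarily closed) admits a measurable selection taking values in its
relative interior. -/
theorem measurable_selection_relative_interior
    {Ω : Type*} [MeasurableSpace Ω] (k : ℕ)
    (U : Ω → Set (Fin k → ℝ))
    (hUmeas : ∀ O : Set (Fin k → ℝ), IsOpen O → MeasurableSet {ω | (U ω ∩ O).Nonempty})
    (hUne : ∀ ω, (U ω).Nonempty) (hUconv : ∀ ω, Convex ℝ (U ω)) :
    ∃ ζ : Ω → (Fin k → ℝ), Measurable ζ ∧ ∀ ω, ζ ω ∈ intrinsicInterior ℝ (U ω) := by
  obtain ⟨f, hfm, hfU, hfd⟩ := exists_castaing_representation hUmeas hUne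
  let c : ℕ → Ω → ℝ := fun n ω => (1 / 2) ^ n / (1 + ‖f n ω‖)
  have hden : ∀ n ω, 0 < 1 + ‖f n ω‖ := fun n ω => by positivity
  have hc : ∀ n ω, 0 < c n ω := fun n ω => div_pos (by positivity) (hden n ω)
  have hcm : ∀ n, Measurable (c n) := fun n =>
    measurable_const.div (measurable_const.add (hfm n).norm)
  have hcs : ∀ ω, Summable fun n => c n ω := fun ω =>
    Summable.of_nonneg_of_le (fun n => (hc n ω).le)
      (fun n => div_le_self (by positivity) (by linarith [norm_nonneg (f n ω)]))
      summable_geometric_two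
  have hfs : ∀ ω, Summable fun n => c n ω • f n ω := fun ω =>
    Summable.of_norm_bounded summable_geometric_two fun n => by
      rw [norm_smul, Real.norm_of_nonneg (hc n ω).le, div_mul_eq_mul_div, div_le_iff₀ (hden n ω)]
      exact mul_le_mul_of_nonneg_left (by linarith) (by positivity)
  have hW : ∀ ω, 0 < ∑' n, c n ω := fun ω => (hcs ω).tsum_pos (fun n => (hc n ω).le) 0 (hc 0 ω)
  have hWm : Measurable fun ω => ∑' n, c n ω :=
    measurable_of_tendsto_metrizable
      (fun n => Finset.measurable_fun_sum (Finset.range n) fun i _ => hcm i)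
      (tendsto_pi_nhds.2 fun ω => (hcs ω).hasSum.tendsto_sum_nat)
  have hFm : Measurable fun ω => ∑' n, c n ω • f n ω :=
    measurable_of_tendsto_metrizable
      (fun n => Finset.measurable_fun_sum (Finset.range n) fun i _ => (hcm i).smul (hfm i))
      (tendsto_pi_nhds.2 fun ω => (hfs ω).hasSum.tendsto_sum_nat)
  refine ⟨fun ω => (∑' n, c n ω)⁻¹ • ∑' n, c n ω • f n ω, hWm.inv.smul hFm, fun ω => ?_⟩
  refine mem_intrinsicInterior_of_hasSum_smul (hUconv ω) (hUne ω) (fun n => hfU n ω) (hfd ω)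
    (w := fun n => (∑' n, c n ω)⁻¹ * c n ω) (fun n => mul_pos (inv_pos.2 (hW ω)) (hc n ω)) ?_ ?_
  · simpa [inv_mul_cancel₀ (hW ω).ne'] using (hcs ω).hasSum.mul_left (∑' n, c n ω)⁻¹
  · simpa only [mul_smul] using (hfs ω).hasSum.const_smul (∑' n, c n ω)⁻¹

end MSPPaper
end
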